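/- arXiv:2503.11401 — 8 statements merged into one kernel-verified Lean document; each statement's English description precedes it below -/
import Mathlib

section
/- Let f > 0 and W ∈ ℝ, and set A = √(1+W²)·√(f+W²) − W² and C = W·(√(1+W²) − √(f+W²)). Then the 2×2 real matrix P = !![A/f, C/f; C, A] satisfies Pᵀ · diag(−f, 1/f) · P = diag(−1, 1). In other words, the Jacobian of the coordinate transformation between the exterior Schwarzschild coordinates (t, r₊) and the interior Minkowski coordinates (T, r₋) at the shell is an isometry from the two-dimensional Minkowski metric −dT² + dr² to the two-dimensional Schwarzschild metric −f dt² + f⁻¹ dr². -/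
open Matrix

/-- The Jacobian of the junction coordinate transformation at the shell is an
isometry from the 2D Minkowski metric diag(-1,1) to the 2D Schwarzschild
metric diag(-f, 1/f). -/
theorem junction_jacobian_isometry (f W A C : ℝ) (hf : 0 < f)
    (hA : A = Real.sqrt (1 + W ^ 2) * Real.sqrt (f + W ^ 2) - W ^ 2)
    (hC : C = W * (Real.sqrt (1 + W ^ 2) - Real.sqrt (f + W ^ 2))) :
    (!![A / f, C / f; C, A])ᵀ * !![-f, 0; 0, 1 / f] * !![A / f, C / f; C, A] =
      !![(-1 : ℝ), 0; 0, 1] := by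
  have h : A ^ 2 - C ^ 2 = f := by
    have ha : Real.sqrt (1 + W ^ 2) ^ 2 = 1 + W ^ 2 := Real.sq_sqrt (by positivity)
    have hb : Real.sqrt (f + W ^ 2) ^ 2 = f + W ^ 2 := Real.sq_sqrt (by positivity)
    rw [hA, hC]
    generalize Real.sqrt (1 + W ^ 2) = a at *
    generalize Real.sqrt (f + W ^ 2) = b at *
    linear_combination (b ^ 2 - W ^ 2) * ha + hb
  clear hA hC
  have hf0 : f ≠ 0 := hf.ne'
  ext i j
  fin_cases i <;> fin_cases j <;> simp [Matrix.mul_apply, Fin.sum_univ_two] <;> field_simp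
  · linear_combination -h
  · ring
  · ring
  · linear_combination h
end

section
/- Let f > 0 and W ∈ ℝ, and set A = √(1+W²)·√(f+W²) − W² and C = W·(√(1+W²) − √(f+W²)). Then the matrix P = !![A/f, C/f; C, A] has determinant 1 and its inverse is P⁻¹ = !![A, −C/f; −C, A/f]. -/
/-- The junction Jacobian matrix P = !![A/f, C/f; C, A] has determinant 1 and
inverse !![A, −C/f; −C, A/f]. -/
theorem junction_jacobian_det_inv (f W A C : ℝ) (hf : 0 < f)
    (hA : A = Real.sqrt (1 + W ^ 2) * Real.sqrt (f + W ^ 2) - W ^ 2)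
    (hC : C = W * (Real.sqrt (1 + W ^ 2) - Real.sqrt (f + W ^ 2))) :
    (!![A / f, C / f; C, A]).det = 1 ∧
      (!![A / f, C / f; C, A])⁻¹ = !![A, -C / f; -C, A / f] := by
  have hs : Real.sqrt (1 + W ^ 2) ^ 2 = 1 + W ^ 2 := Real.sq_sqrt (by positivity)
  have ht : Real.sqrt (f + W ^ 2) ^ 2 = f + W ^ 2 := Real.sq_sqrt (by positivity)
  generalize Real.sqrt (1 + W ^ 2) = s at *
  generalize Real.sqrt (f + W ^ 2) = t at *
  have key : A ^ 2 - C ^ 2 = f := by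
    have h : A ^ 2 - C ^ 2 = (s ^ 2 - W ^ 2) * (t ^ 2 - W ^ 2) := by
      rw [hA, hC]; ring
    rw [h, hs, ht]; ring
  have hd : (!![A / f, C / f; C, A]).det = 1 := by
    rw [Matrix.det_fin_two_of]
    field_simp
    linarith
  refine ⟨hd, ?_⟩
  rw [Matrix.inv_def, hd, Matrix.adjugate_fin_two_of, Ring.inverse_one, one_smul, neg_div]
end

section
/- Let f ∈ (0,1) and W ∈ ℝ, and set A(W,f) = √(1+W²)·√(f+W²) − W². Then √f ≤ A(W,f) < (1+f)/2, and A(W,f) = √f holds if and only if W = 0. -/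
/-- Bounds on the time-time junction coefficient A(W,f): for f ∈ (0,1),
√f ≤ A(W,f) < (1+f)/2, with equality A = √f iff W = 0. -/
theorem junction_A_bounds (f W : ℝ) (hf : f ∈ Set.Ioo (0 : ℝ) 1) :
    Real.sqrt f ≤ Real.sqrt (1 + W ^ 2) * Real.sqrt (f + W ^ 2) - W ^ 2 ∧
      Real.sqrt (1 + W ^ 2) * Real.sqrt (f + W ^ 2) - W ^ 2 < (1 + f) / 2 ∧
      (Real.sqrt (1 + W ^ 2) * Real.sqrt (f + W ^ 2) - W ^ 2 = Real.sqrt f ↔ W = 0) := by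
  obtain ⟨h0, h1⟩ := hf
  have hW : 0 ≤ W ^ 2 := sq_nonneg W
  rw [← Real.sqrt_mul (by positivity)]
  have hs : Real.sqrt f ^ 2 = f := Real.sq_sqrt h0.le
  have hs0 : 0 < Real.sqrt f := Real.sqrt_pos.mpr h0
  have hs1 : Real.sqrt f < 1 := by nlinarith
  have key : (1 + W ^ 2) * (f + W ^ 2)
      = (Real.sqrt f + W ^ 2) ^ 2 + W ^ 2 * (1 - Real.sqrt f) ^ 2 := by
    linear_combination (-1 - W ^ 2) * hs
  refine ⟨?_, ?_, ?_, ?_⟩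
  · have : Real.sqrt f + W ^ 2 ≤ Real.sqrt ((1 + W ^ 2) * (f + W ^ 2)) := by
      apply Real.le_sqrt_of_sq_le
      rw [key]
      have : 0 ≤ W ^ 2 * (1 - Real.sqrt f) ^ 2 := by positivity
      linarith
    linarith
  · have : Real.sqrt ((1 + W ^ 2) * (f + W ^ 2)) < (1 + f) / 2 + W ^ 2 := by
      rw [Real.sqrt_lt' (by positivity)]
      have : 0 < (1 - f) ^ 2 := pow_pos (by linarith) 2
      nlinarith
    linarith
  · intro h
    have hP : Real.sqrt ((1 + W ^ 2) * (f + W ^ 2)) ^ 2 = (1 + W ^ 2) * (f + W ^ 2) :=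
      Real.sq_sqrt (by positivity)
    have h2 : Real.sqrt ((1 + W ^ 2) * (f + W ^ 2)) = Real.sqrt f + W ^ 2 := by linarith
    rw [h2, key] at hP
    have h3 : W ^ 2 * (1 - Real.sqrt f) ^ 2 = 0 := by linarith
    have h4 : (1 - Real.sqrt f) ^ 2 ≠ 0 := pow_ne_zero 2 (by linarith)
    exact pow_eq_zero_iff (two_ne_zero) |>.mp ((mul_eq_zero.mp h3).resolve_right h4)
  · rintro rfl
    simp
end

section
/- Let f₁, f₂ > 0, r₁ > 0, b₂ ≥ 0, s₂ ∈ ℝ, W₁, W₂ ∈ ℝ, and σ₂ ∈ {−1, +1}. Set Aᵢ = √(1+Wᵢ²)·√(fᵢ+Wᵢ²) − Wᵢ² and Cᵢ = Wᵢ·(√(1+Wᵢ²) − √(fᵢ+Wᵢ²)) for i = 1,2, and let D = A₂ − σ₂C₂s₂. Assume D² ≥ b₂²f₂²/r₁² and D² + C₁²b₂²f₂²/(f₁r₁²) ≠ 0. Then for either choice of sign ε ∈ {−1, +1}, the number α = (f₂/f₁)·[A₁D + ε·C₁·√(D² − b₂²f₂²/r₁²)] / [D² + C₁²b₂²f₂²/(f₁r₁²)]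 satisfies the implicit redshift equation in squared form: (f₁·D·α/f₂ − A₁)² = C₁²·(1 − α²·b₂²·f₁/r₁²). -/
/-- The explicit redshift factor α solves the implicit redshift equation in
squared form: (f₁·D·α/f₂ − A₁)² = C₁²·(1 − α²·b₂²·f₁/r₁²). -/
theorem redshift_explicit_solves_implicit
    (f₁ f₂ r₁ b₂ s₂ W₁ W₂ σ₂ ε A₁ C₁ A₂ C₂ D α : ℝ)
    (hf₁ : 0 < f₁) (hf₂ : 0 < f₂) (hr₁ : 0 < r₁) (hb₂ : 0 ≤ b₂)
    (hσ : σ₂ = -1 ∨ σ₂ = 1) (hε : ε = -1 ∨ ε = 1)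
    (hA₁ : A₁ = Real.sqrt (1 + W₁ ^ 2) * Real.sqrt (f₁ + W₁ ^ 2) - W₁ ^ 2)
    (hC₁ : C₁ = W₁ * (Real.sqrt (1 + W₁ ^ 2) - Real.sqrt (f₁ + W₁ ^ 2)))
    (hA₂ : A₂ = Real.sqrt (1 + W₂ ^ 2) * Real.sqrt (f₂ + W₂ ^ 2) - W₂ ^ 2)
    (hC₂ : C₂ = W₂ * (Real.sqrt (1 + W₂ ^ 2) - Real.sqrt (f₂ + W₂ ^ 2)))
    (hD : D = A₂ - σ₂ * C₂ * s₂)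
    (hDK : b₂ ^ 2 * f₂ ^ 2 / r₁ ^ 2 ≤ D ^ 2)
    (hN : D ^ 2 + C₁ ^ 2 * b₂ ^ 2 * f₂ ^ 2 / (f₁ * r₁ ^ 2) ≠ 0)
    (hα : α = (f₂ / f₁) *
        (A₁ * D + ε * C₁ * Real.sqrt (D ^ 2 - b₂ ^ 2 * f₂ ^ 2 / r₁ ^ 2)) /
        (D ^ 2 + C₁ ^ 2 * b₂ ^ 2 * f₂ ^ 2 / (f₁ * r₁ ^ 2))) :
    (f₁ * D * α / f₂ - A₁) ^ 2 = C₁ ^ 2 * (1 - α ^ 2 * b₂ ^ 2 * f₁ / r₁ ^ 2) := by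
  have hu : Real.sqrt (1 + W₁ ^ 2) ^ 2 = 1 + W₁ ^ 2 := Real.sq_sqrt (by positivity)
  have hv : Real.sqrt (f₁ + W₁ ^ 2) ^ 2 = f₁ + W₁ ^ 2 := Real.sq_sqrt (by positivity)
  have hAC : A₁ ^ 2 - C₁ ^ 2 = f₁ := by
    rw [hA₁, hC₁]
    generalize Real.sqrt (1 + W₁ ^ 2) = u at *
    generalize Real.sqrt (f₁ + W₁ ^ 2) = v at *
    have h : (u * v - W₁ ^ 2) ^ 2 - (W₁ * (u - v)) ^ 2
        = (u ^ 2 - W₁ ^ 2) * (v ^ 2 - W₁ ^ 2) := by ring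
    rw [h, hu, hv]; ring
  have hq : Real.sqrt (D ^ 2 - b₂ ^ 2 * f₂ ^ 2 / r₁ ^ 2) ^ 2
      = D ^ 2 - b₂ ^ 2 * f₂ ^ 2 / r₁ ^ 2 := Real.sq_sqrt (by linarith)
  have hε2 : ε ^ 2 = 1 := by rcases hε with h | h <;> rw [h] <;> norm_num
  generalize Real.sqrt (D ^ 2 - b₂ ^ 2 * f₂ ^ 2 / r₁ ^ 2) = q at *
  obtain ⟨K, hK⟩ : ∃ K, K = b₂ ^ 2 * f₂ ^ 2 / r₁ ^ 2 := ⟨_, rfl⟩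
  obtain ⟨N, hNd⟩ : ∃ N, N = D ^ 2 + C₁ ^ 2 * b₂ ^ 2 * f₂ ^ 2 / (f₁ * r₁ ^ 2) := ⟨_, rfl⟩
  rw [← hNd] at hN hα
  rw [← hK] at hq
  have hNK : N * f₁ = D ^ 2 * f₁ + C₁ ^ 2 * K := by
    rw [hNd, hK]; field_simp
  obtain ⟨x, hx⟩ : ∃ x, x = f₁ * α / f₂ := ⟨_, rfl⟩
  have hNx : N * x = A₁ * D + ε * C₁ * q := by
    rw [hx, hα]; field_simp
  have hsq : (N * x - A₁ * D) ^ 2 = C₁ ^ 2 * (D ^ 2 - K) := by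
    rw [hNx, ← hq]
    linear_combination C₁ ^ 2 * q ^ 2 * hε2
  have hquad : N * x ^ 2 - 2 * A₁ * D * x + f₁ = 0 := by
    apply mul_left_cancel₀ hN
    linear_combination hsq + hNK - D ^ 2 * hAC
  have e1 : f₁ * D * α / f₂ = D * x := by rw [hx]; ring
  have e2 : α ^ 2 * b₂ ^ 2 * f₁ / r₁ ^ 2 = x ^ 2 * K / f₁ := by
    rw [hx, hK]; field_simp
  rw [e1, e2]
  have hN2 : N = D ^ 2 + C₁ ^ 2 * K / f₁ := by
    rw [hNd, hK]; field_simp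
  rw [hN2] at hquad
  linear_combination hquad + hAC
end

section
/- Let M > 0, let 2M < r₂ < r₁, and set fᵢ = 1 − 2M/rᵢ for i = 1,2. Let W₂ ≤ 0 and s₂ ∈ [0,1]. Set A₂ = √(1+W₂²)·√(f₂+W₂²) − W₂² and C₂ = W₂·(√(1+W₂²) − √(f₂+W₂²)). Then the redshift factor α = (f₂/f₁)·√f₁ / (A₂ − C₂·s₂) satisfies 0 < α ≤ √(f₂/f₁) < 1. In particular, a light ray that enters a momentarily static shell at radius r₁ and exits a collapsing (or momentarily static) shell outwardly at a smaller radius r₂ is always redshifted. -/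
/-- A light ray entering a momentarily static shell at radius r₁ and exiting
a collapsing (or momentarily static) shell outwardly at a smaller radius r₂
is always redshifted: 0 < α ≤ √(f₂/f₁) < 1. -/
theorem collapse_outgoing_redshift
    (M r₁ r₂ W₂ s₂ f₁ f₂ A₂ C₂ α : ℝ)
    (hM : 0 < M) (h2 : 2 * M < r₂) (h12 : r₂ < r₁)
    (hf₁ : f₁ = 1 - 2 * M / r₁) (hf₂ : f₂ = 1 - 2 * M / r₂)
    (hW : W₂ ≤ 0) (hs : s₂ ∈ Set.Icc (0 : ℝ) 1)
    (hA₂ : A₂ = Real.sqrt (1 + W₂ ^ 2) * Real.sqrt (f₂ + W₂ ^ 2) - W₂ ^ 2)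
    (hC₂ : C₂ = W₂ * (Real.sqrt (1 + W₂ ^ 2) - Real.sqrt (f₂ + W₂ ^ 2)))
    (hα : α = (f₂ / f₁) * Real.sqrt f₁ / (A₂ - C₂ * s₂)) :
    0 < α ∧ α ≤ Real.sqrt (f₂ / f₁) ∧ Real.sqrt (f₂ / f₁) < 1 := by
  have hr2 : 0 < r₂ := by linarith
  have hr1 : 0 < r₁ := by linarith
  have hf2 : 0 < f₂ := by
    rw [hf₂, sub_pos, div_lt_one hr2]; exact h2
  have hlt : f₂ < f₁ := by
    rw [hf₁, hf₂]
    have : 2 * M / r₁ < 2 * M / r₂ := div_lt_div_of_pos_left (by linarith) hr2 h12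
    linarith
  have hf1 : 0 < f₁ := hf2.trans hlt
  have hf2' : f₂ < 1 := by
    have : 0 < 2 * M / r₂ := by positivity
    linarith
  have hA : Real.sqrt f₂ ≤ A₂ := by
    rw [hA₂, ← Real.sqrt_mul (by positivity), le_sub_iff_add_le]
    apply Real.le_sqrt_of_sq_le
    have h := Real.sq_sqrt hf2.le
    nlinarith [mul_nonneg (sq_nonneg W₂) (sq_nonneg (Real.sqrt f₂ - 1))]
  have hC : C₂ ≤ 0 := by
    rw [hC₂]
    apply mul_nonpos_of_nonpos_of_nonneg hW
    exact sub_nonneg.2 (Real.sqrt_le_sqrt (by linarith))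
  have hD : Real.sqrt f₂ ≤ A₂ - C₂ * s₂ := by
    have := mul_nonpos_of_nonpos_of_nonneg hC hs.1
    linarith
  have q2 : 0 < Real.sqrt f₂ := Real.sqrt_pos.2 hf2
  have q1 : 0 < Real.sqrt f₁ := Real.sqrt_pos.2 hf1
  have hD0 : 0 < A₂ - C₂ * s₂ := q2.trans_le hD
  refine ⟨by rw [hα]; positivity, ?_, ?_⟩
  · rw [hα, div_le_iff₀ hD0, Real.sqrt_div hf2.le]
    have e : f₂ / f₁ * Real.sqrt f₁ = Real.sqrt f₂ / Real.sqrt f₁ * Real.sqrt f₂ := by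
      have h1 := Real.sq_sqrt hf1.le
      have h2 := Real.sq_sqrt hf2.le
      rw [div_mul_eq_mul_div, div_mul_eq_mul_div, div_eq_div_iff hf1.ne' q1.ne']
      linear_combination f₂ * h1 - f₁ * h2
    rw [e]
    exact mul_le_mul_of_nonneg_left hD (by positivity)
  · rw [Real.sqrt_lt' one_pos, one_pow, div_lt_one hf1]
    exact hlt
end

section
/- Let M > 0, let 2M < r₁ < r₂, and set fᵢ = 1 − 2M/rᵢ for i = 1,2. Let W₂ ≥ 0 and let s₂ satisfy W₂/√(f₂+W₂²) < s₂ ≤ 1. Set A₂ = √(1+W₂²)·√(f₂+W₂²) − W₂² and C₂ = W₂·(√(1+W₂²) − √(f₂+W₂²)). Then the redshift factor α = (f₂/f₁)·√f₁ / (A₂ − C₂·s₂) satisfies α > 1. In particular, a light ray that enters a momentarily static shell at radius r₁ and exits an expanding (or momentarily static) shell outwardly at a larger radius r₂ is always blueshifted. -/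
/-- A light ray entering a momentarily static shell at radius r₁ and exiting
an expanding (or momentarily static) shell outwardly at a larger radius r₂
is always blueshifted: α > 1. -/
theorem expansion_outgoing_blueshift
    (M r₁ r₂ W₂ s₂ f₁ f₂ A₂ C₂ α : ℝ)
    (hM : 0 < M) (h1 : 2 * M < r₁) (h12 : r₁ < r₂)
    (hf₁ : f₁ = 1 - 2 * M / r₁) (hf₂ : f₂ = 1 - 2 * M / r₂)
    (hW : 0 ≤ W₂)
    (hs_lo : W₂ / Real.sqrt (f₂ + W₂ ^ 2) < s₂) (hs_hi : s₂ ≤ 1)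
    (hA₂ : A₂ = Real.sqrt (1 + W₂ ^ 2) * Real.sqrt (f₂ + W₂ ^ 2) - W₂ ^ 2)
    (hC₂ : C₂ = W₂ * (Real.sqrt (1 + W₂ ^ 2) - Real.sqrt (f₂ + W₂ ^ 2)))
    (hα : α = (f₂ / f₁) * Real.sqrt f₁ / (A₂ - C₂ * s₂)) :
    1 < α := by
  have hr1 : 0 < r₁ := by linarith
  have hr2 : 0 < r₂ := by linarith
  have f1pos : 0 < f₁ := by
    rw [hf₁, sub_pos, div_lt_one hr1]; exact h1
  have f12 : f₁ < f₂ := by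
    rw [hf₁, hf₂]
    have : 2 * M / r₂ < 2 * M / r₁ := div_lt_div_of_pos_left (by linarith) hr1 h12
    linarith
  have f2pos : 0 < f₂ := f1pos.trans f12
  have f2lt : f₂ < 1 := by
    rw [hf₂]
    have : 0 < 2 * M / r₂ := by positivity
    linarith
  have hab : Real.sqrt f₁ < Real.sqrt f₂ := Real.sqrt_lt_sqrt f1pos.le f12
  have ha : 0 < Real.sqrt f₁ := Real.sqrt_pos.2 f1pos
  have ha2 : Real.sqrt f₁ ^ 2 = f₁ := Real.sq_sqrt f1pos.le
  have hg2 : Real.sqrt f₂ ^ 2 = f₂ := Real.sq_sqrt f2pos.le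
  have hP : 0 < Real.sqrt (1 + W₂ ^ 2) := Real.sqrt_pos.2 (by positivity)
  have hP2 : Real.sqrt (1 + W₂ ^ 2) ^ 2 = 1 + W₂ ^ 2 := Real.sq_sqrt (by positivity)
  have hQ : 0 < Real.sqrt (f₂ + W₂ ^ 2) := Real.sqrt_pos.2 (by positivity)
  have hQ2 : Real.sqrt (f₂ + W₂ ^ 2) ^ 2 = f₂ + W₂ ^ 2 := Real.sq_sqrt (by positivity)
  have hQP : Real.sqrt (f₂ + W₂ ^ 2) ≤ Real.sqrt (1 + W₂ ^ 2) :=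
    Real.sqrt_le_sqrt (by linarith)
  rw [div_lt_iff₀ hQ] at hs_lo
  generalize Real.sqrt (1 + W₂ ^ 2) = P at *
  generalize Real.sqrt (f₂ + W₂ ^ 2) = Q at *
  generalize Real.sqrt f₁ = a at *
  generalize Real.sqrt f₂ = g at *
  have hg : 0 < g := ha.trans hab
  have hQW : W₂ < Q := by nlinarith
  have hC : 0 ≤ C₂ := by rw [hC₂]; exact mul_nonneg hW (by linarith)
  have hD : 0 < A₂ - C₂ * s₂ := by
    have h3 : C₂ * s₂ ≤ C₂ * 1 := mul_le_mul_of_nonneg_left hs_hi hC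
    have h4 : 0 < (P + W₂) * (Q - W₂) := mul_pos (by linarith) (by linarith)
    have h5 : A₂ - C₂ * 1 = (P + W₂) * (Q - W₂) := by rw [hA₂, hC₂]; ring
    linarith
  have hPg : P * g ≤ Q := by
    refine (sq_le_sq₀ (by positivity) hQ.le).1 ?_
    rw [mul_pow, hP2, hg2, hQ2]
    nlinarith [mul_nonneg (sub_nonneg.2 f2lt.le) (sq_nonneg W₂)]
  have hDg : A₂ - C₂ * s₂ ≤ g := by
    have h3 : C₂ * W₂ ≤ C₂ * (s₂ * Q) := mul_le_mul_of_nonneg_left hs_lo.le hC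
    have h4 : A₂ * Q - C₂ * W₂ = P * g * g := by
      have : P * g * g = P * (Q ^ 2 - W₂ ^ 2) := by rw [hQ2, ← hg2]; ring
      rw [this, hA₂, hC₂]; ring
    have h5 : P * g * g ≤ Q * g := mul_le_mul_of_nonneg_right hPg hg.le
    have h6 : (A₂ - C₂ * s₂) * Q ≤ g * Q := by linarith
    exact le_of_mul_le_mul_right h6 hQ
  have e : f₂ / f₁ * a = g ^ 2 / a := by
    rw [← ha2, ← hg2]; field_simp
  rw [hα, e, lt_div_iff₀ hD, one_mul, lt_div_iff₀ ha]
  calc (A₂ - C₂ * s₂) * a ≤ g * a := mul_le_mul_of_nonneg_right hDg ha.le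
    _ < g ^ 2 := by nlinarith
end

section
/- Let M > 0, r₁ > 2M, f₁ = 1 − 2M/r₁, W₂ ≤ 0, and b₂ ≥ 0. Define for r₂ ∈ (2M, r₁) the redshift factor α(r₂) = (f(r₂)/f₁)·√f₁ / (A(W₂, f(r₂)) − C(W₂, f(r₂))·√(1 − b₂²f(r₂)/r₂²)), where f(r) = 1 − 2M/r, A(W,f) = √(1+W²)√(f+W²) − W², and C(W,f) = W(√(1+W²) − √(f+W²)). Then α(r₂) → 0 as r₂ → 2M from the right. That is, the redshift of an outgoing light ray exiting the collapsing shell becomes infinite (α → 0) as the shell approaches the horizon radius, for any fixed impact parameter. -/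
/-- The redshift of an outgoing light ray exiting the collapsing shell becomes
infinite (α → 0) as the shell approaches the horizon radius r₂ → 2M⁺, for any
fixed impact parameter. -/
theorem infinite_redshift_near_horizon
    (M r₁ W₂ b₂ : ℝ) (hM : 0 < M) (hr₁ : 2 * M < r₁) (hW : W₂ ≤ 0) (hb : 0 ≤ b₂) :
    Filter.Tendsto
      (fun r₂ : ℝ =>
        ((1 - 2 * M / r₂) / (1 - 2 * M / r₁)) * Real.sqrt (1 - 2 * M / r₁) /
          ((Real.sqrt (1 + W₂ ^ 2) * Real.sqrt ((1 - 2 * M / r₂) + W₂ ^ 2) - W₂ ^ 2) -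
            W₂ * (Real.sqrt (1 + W₂ ^ 2) - Real.sqrt ((1 - 2 * M / r₂) + W₂ ^ 2)) *
              Real.sqrt (1 - b₂ ^ 2 * (1 - 2 * M / r₂) / r₂ ^ 2)))
      (nhdsWithin (2 * M) (Set.Ioo (2 * M) r₁)) (nhds 0) := by
  have h2M : (2 * M) ≠ 0 := by positivity
  have hf : ContinuousAt (fun r : ℝ => 1 - 2 * M / r) (2 * M) :=
    continuousAt_const.sub (continuousAt_const.div continuousAt_id h2M)
  have h0 : 1 - 2 * M / (2 * M) = 0 := by rw [div_self h2M, sub_self]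
  refine Filter.Tendsto.mono_left ?_ nhdsWithin_le_nhds
  rcases hW.eq_or_lt with h | h
  · subst h
    have hc : ContinuousAt (fun r : ℝ => Real.sqrt (1 - 2 * M / r) *
        (Real.sqrt (1 - 2 * M / r₁) / (1 - 2 * M / r₁))) (2 * M) :=
      hf.sqrt.mul continuousAt_const
    have ht := hc.tendsto
    simp only [h0, Real.sqrt_zero, zero_mul] at ht
    refine ht.congr fun r => ?_
    have hd : (1 - 2 * M / r) / Real.sqrt (1 - 2 * M / r) = Real.sqrt (1 - 2 * M / r) :=
      Real.div_sqrt
    simp only [ne_eq, OfNat.ofNat_ne_zero, not_false_eq_true, zero_pow, add_zero,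
      Real.sqrt_one, one_mul, sub_zero, zero_mul]
    conv_lhs => rw [← hd]
    ring
  · have hden : (Real.sqrt (1 + W₂ ^ 2) * Real.sqrt ((1 - 2 * M / (2 * M)) + W₂ ^ 2) - W₂ ^ 2) -
            W₂ * (Real.sqrt (1 + W₂ ^ 2) - Real.sqrt ((1 - 2 * M / (2 * M)) + W₂ ^ 2)) *
              Real.sqrt (1 - b₂ ^ 2 * (1 - 2 * M / (2 * M)) / (2 * M) ^ 2) ≠ 0 := by
      have hs : -W₂ < Real.sqrt (1 + W₂ ^ 2) := by
        apply Real.lt_sqrt_of_sq_lt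
        nlinarith
      rw [h0, zero_add, Real.sqrt_sq_eq_abs, abs_of_neg h, mul_zero, zero_div, sub_zero,
        Real.sqrt_one]
      nlinarith
    have hs2 : ContinuousAt (fun r : ℝ => Real.sqrt ((1 - 2 * M / r) + W₂ ^ 2)) (2 * M) :=
      (hf.add continuousAt_const).sqrt
    have hs3 : ContinuousAt (fun r : ℝ =>
        Real.sqrt (1 - b₂ ^ 2 * (1 - 2 * M / r) / r ^ 2)) (2 * M) :=
      (continuousAt_const.sub ((continuousAt_const.mul hf).div (continuousAt_id.pow 2)
        (pow_ne_zero 2 h2M))).sqrt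
    have hc := (((hf.div_const (1 - 2 * M / r₁)).mul
      (continuousAt_const (y := Real.sqrt (1 - 2 * M / r₁)))).div
      (((continuousAt_const.mul hs2).sub continuousAt_const).sub
        ((continuousAt_const.mul (continuousAt_const.sub hs2)).mul hs3)) hden)
    have ht := hc.tendsto
    convert ht using 2
    · rfl
    · simp only [Pi.div_apply, Pi.mul_apply, h0, zero_div, zero_mul]
end

section
/- Let M > 0 and 2M < r₂ < r₁, and set fᵢ = 1 − 2M/rᵢ. Define for W < 0 the quantity α(W) = (f₂/f₁)·√f₁ / (A(W, f₂) + C(W, f₂)), where A(W,f) = √(1+W²)√(f+W²) − W² and C(W,f) = W(√(1+W²) − √(f+W²)). Then α(W) → 1/√f₁ as W → −∞, and 1/√f₁ > 1. In particular, for a sufficiently rapidly collapsing shell, a radially ingoing light ray (b₂ = 0, σ₂ = −1 at exit) that entered a momentarily static shell at radius r₁ is blueshifted, α(W) > 1. -/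
theorem shell_denominator_tendsto (f : ℝ) (h0 : 0 < f) (h1 : f < 1) :
    Filter.Tendsto (fun W : ℝ =>
      ((Real.sqrt (1 + W ^ 2) * Real.sqrt (f + W ^ 2) - W ^ 2) +
        W * (Real.sqrt (1 + W ^ 2) - Real.sqrt (f + W ^ 2)))) Filter.atBot (nhds f) := by
  have hlim : Filter.Tendsto (fun W : ℝ => f + f / (-W)) Filter.atBot (nhds f) := by
    have := (Filter.tendsto_neg_atBot_atTop (G := ℝ)).const_div_atTop f
    simpa using this.const_add f
  have key : ∀ W : ℝ, W < 0 →
      f ≤ ((Real.sqrt (1 + W ^ 2) * Real.sqrt (f + W ^ 2) - W ^ 2) +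
        W * (Real.sqrt (1 + W ^ 2) - Real.sqrt (f + W ^ 2))) ∧
      ((Real.sqrt (1 + W ^ 2) * Real.sqrt (f + W ^ 2) - W ^ 2) +
        W * (Real.sqrt (1 + W ^ 2) - Real.sqrt (f + W ^ 2))) ≤ f + f / (-W) := by
    intro W hW
    have ha2 : Real.sqrt (1 + W ^ 2) ^ 2 = 1 + W ^ 2 := Real.sq_sqrt (by positivity)
    have hb2 : Real.sqrt (f + W ^ 2) ^ 2 = f + W ^ 2 := Real.sq_sqrt (by positivity)
    have hb0 : 0 ≤ Real.sqrt (f + W ^ 2) := Real.sqrt_nonneg _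
    have hab : Real.sqrt (f + W ^ 2) ≤ Real.sqrt (1 + W ^ 2) :=
      Real.sqrt_le_sqrt (by linarith)
    generalize Real.sqrt (1 + W ^ 2) = a at *
    generalize Real.sqrt (f + W ^ 2) = b at *
    have hab1 : a ≤ b + 1 := by nlinarith
    have hp : 0 < b - W := by linarith
    have hD : (a * b - W ^ 2) + W * (a - b) = f * (a - W) / (b - W) := by
      rw [eq_div_iff hp.ne']
      linear_combination (a - W) * hb2
    rw [hD]
    constructor
    · rw [le_div_iff₀ hp]
      nlinarith
    · have e1 : f * (a - W) / (b - W) ≤ f + f / (b - W) := by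
        rw [div_le_iff₀ hp, add_mul, div_mul_cancel₀ _ hp.ne']
        nlinarith
      have e2 : f / (b - W) ≤ f / (-W) :=
        div_le_div_of_nonneg_left h0.le (by linarith) (by linarith)
      linarith
  refine tendsto_of_tendsto_of_tendsto_of_le_of_le' tendsto_const_nhds hlim ?_ ?_
  · filter_upwards [Filter.eventually_lt_atBot 0] with W hW using (key W hW).1
  · filter_upwards [Filter.eventually_lt_atBot 0] with W hW using (key W hW).2

/-- A radially ingoing light ray exiting a rapidly collapsing shell is
blueshifted: α(W) → 1/√f₁ > 1 as W → −∞, so α(W) > 1 for sufficiently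
rapid collapse. -/
theorem rapid_collapse_ingoing_blueshift
    (M r₁ r₂ f₁ f₂ : ℝ) (hM : 0 < M) (h2 : 2 * M < r₂) (h12 : r₂ < r₁)
    (hf₁ : f₁ = 1 - 2 * M / r₁) (hf₂ : f₂ = 1 - 2 * M / r₂) :
    Filter.Tendsto
        (fun W : ℝ =>
          (f₂ / f₁) * Real.sqrt f₁ /
            ((Real.sqrt (1 + W ^ 2) * Real.sqrt (f₂ + W ^ 2) - W ^ 2) +
              W * (Real.sqrt (1 + W ^ 2) - Real.sqrt (f₂ + W ^ 2))))
        Filter.atBot (nhds (1 / Real.sqrt f₁)) ∧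
      1 < 1 / Real.sqrt f₁ ∧
      ∀ᶠ W : ℝ in Filter.atBot,
        1 < (f₂ / f₁) * Real.sqrt f₁ /
          ((Real.sqrt (1 + W ^ 2) * Real.sqrt (f₂ + W ^ 2) - W ^ 2) +
            W * (Real.sqrt (1 + W ^ 2) - Real.sqrt (f₂ + W ^ 2))) := by
  have hr2 : 0 < r₂ := by linarith
  have hr1 : 0 < r₁ := by linarith
  have a1 : 0 < f₁ := by
    rw [hf₁, sub_pos, div_lt_one hr1]; linarith
  have b1 : f₁ < 1 := by
    have : 0 < 2 * M / r₁ := by positivity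
    linarith
  have a2 : 0 < f₂ := by
    rw [hf₂, sub_pos, div_lt_one hr2]; linarith
  have b2 : f₂ < 1 := by
    have : 0 < 2 * M / r₂ := by positivity
    linarith
  have hs : 0 < Real.sqrt f₁ := Real.sqrt_pos.2 a1
  have hs2 : Real.sqrt f₁ ^ 2 = f₁ := Real.sq_sqrt a1.le
  have hlt : 1 < 1 / Real.sqrt f₁ := by
    rw [lt_div_iff₀ hs]; nlinarith
  have ht := (tendsto_const_nhds (x := (f₂ / f₁) * Real.sqrt f₁)).div
    (shell_denominator_tendsto f₂ a2 b2) a2.ne'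
  have he : (f₂ / f₁) * Real.sqrt f₁ / f₂ = 1 / Real.sqrt f₁ := by
    field_simp
    exact hs2
  rw [he] at ht
  exact ⟨ht, hlt, ht.eventually (lt_mem_nhds hlt)⟩
end
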